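/- arXiv:1205.4664 — 2 statements merged into one kernel-verified Lean document; each statement's English description precedes it below -/
import Mathlib

section
/- Let m ≥ 1 and let k < 0 < l be integers. For each integer i with k ≤ i ≤ l let S_i ⊆ ℝ^m be a finite set, and assume S_i ≠ ∅ for at least one i > 0. In ℝ × ℝ × ℝ^m, let σ be the convex cone generated by G = {(1, i, v) : k ≤ i ≤ l, v ∈ S_i} (i.e., the set of all finite nonnegative linear combinations of elements of G), and let u : ℝ × ℝ × ℝ^m → ℝ be the projection onto the second coordinate. Then σ ∩ u^{-1}(1) = (σ ∩ u^{-1}(0)) + convexHull{ (1/i)·(1, i, v) : 1 ≤ i ≤ l, v ∈ S_i }, where + denotes Minkowski sum. -/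
open scoped Pointwise

/-- The convex cone generated by a set `G`: all finite nonnegative linear combinations
of elements of `G`. -/
def coneGen {V : Type*} [AddCommGroup V] [Module ℝ V] (G : Set V) : Set V :=
  {x | ∃ (t : Finset V) (c : V → ℝ), ↑t ⊆ G ∧ (∀ v ∈ t, 0 ≤ c v) ∧ x = ∑ v ∈ t, c v • v}

theorem coneGen_add_mem {V : Type*} [AddCommGroup V] [Module ℝ V] {G : Set V} {x y : V}
    (hx : x ∈ coneGen G) (hy : y ∈ coneGen G) : x + y ∈ coneGen G := by
  classical
  obtain ⟨t, c, ht, hc, rfl⟩ := hx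
  obtain ⟨s, d, hs, hd, rfl⟩ := hy
  refine ⟨t ∪ s, fun v => (if v ∈ t then c v else 0) + (if v ∈ s then d v else 0), ?_, ?_, ?_⟩
  · intro v hv
    rcases Finset.mem_union.1 (Finset.mem_coe.1 hv) with h | h
    · exact ht h
    · exact hs h
  · intro v _
    refine add_nonneg ?_ ?_
    · split_ifs with h
      · exact hc v h
      · exact le_rfl
    · split_ifs with h
      · exact hd v h
      · exact le_rfl
  · simp only [add_smul, Finset.sum_add_distrib, ite_smul, zero_smul, Finset.sum_ite_mem,
      Finset.union_inter_cancel_left, Finset.union_inter_cancel_right]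

theorem coneGen_smul_mem {V : Type*} [AddCommGroup V] [Module ℝ V] {G : Set V} {x : V} {a : ℝ}
    (ha : 0 ≤ a) (hx : x ∈ coneGen G) : a • x ∈ coneGen G := by
  obtain ⟨t, c, ht, hc, rfl⟩ := hx
  refine ⟨t, fun v => a * c v, ht, fun v hv => mul_nonneg ha (hc v hv), ?_⟩
  simp only [Finset.smul_sum, mul_smul]

theorem subset_coneGen {V : Type*} [AddCommGroup V] [Module ℝ V] {G : Set V} {x : V}
    (hx : x ∈ G) : x ∈ coneGen G :=
  ⟨{x}, fun _ => 1, by simpa using hx, fun _ _ => zero_le_one, by simp⟩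

theorem slice_general {V : Type*} [AddCommGroup V] [Module ℝ V] (G : Set V) (u : V →ₗ[ℝ] ℝ) :
    coneGen G ∩ {p | u p = 1} = (coneGen G ∩ {p | u p = 0}) +
      convexHull ℝ {p | ∃ g ∈ G, 0 < u g ∧ p = (u g)⁻¹ • g} := by
  classical
  apply Set.Subset.antisymm
  · rintro x ⟨⟨t, c, ht, hc, rfl⟩, hx⟩
    simp only [Set.mem_ofPred_eq, map_sum, map_smul, smul_eq_mul] at hx
    set P := t.filter (fun v => 0 < u v) with hP
    set A := ∑ v ∈ P, c v * u v with hA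
    have hsplit := Finset.sum_filter_add_sum_filter_not t (fun v => 0 < u v) (fun v => c v * u v)
    have hneg : ∑ v ∈ t.filter (fun v => ¬ 0 < u v), c v * u v ≤ 0 := by
      apply Finset.sum_nonpos
      intro v hv
      rw [Finset.mem_filter] at hv
      exact mul_nonpos_of_nonneg_of_nonpos (hc v hv.1) (not_lt.1 hv.2)
    have hA1 : 1 ≤ A := by linarith
    have hA0 : 0 < A := by linarith
    have hAi : A⁻¹ ≤ 1 := inv_le_one_of_one_le₀ hA1
    have hdec : ∑ v ∈ t, c v • v = ∑ v ∈ t, (if 0 < u v then (1 - A⁻¹) * c v else c v) • v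
        + ∑ v ∈ P, (A⁻¹ * c v) • v := by
      rw [hP, Finset.sum_filter, ← Finset.sum_add_distrib]
      apply Finset.sum_congr rfl
      intro v _
      split_ifs
      · rw [← add_smul]; congr 1; ring
      · simp
    have hu1 : u (∑ v ∈ P, (A⁻¹ * c v) • v) = 1 := by
      simp only [map_sum, map_smul, smul_eq_mul, mul_assoc]
      rw [← Finset.mul_sum, ← hA, inv_mul_cancel₀ hA0.ne']
    refine Set.mem_add.2 ⟨_, ⟨⟨t, _, ht, ?_, rfl⟩, ?_⟩, _, ?_, hdec.symm⟩
    · intro v hv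
      have := hc v hv
      have h2 : 0 ≤ 1 - A⁻¹ := by linarith
      split_ifs
      · positivity
      · exact this
    · have h := congrArg u hdec
      rw [map_add, hu1] at h
      have hx' : u (∑ v ∈ t, c v • v) = 1 := by
        simp only [map_sum, map_smul, smul_eq_mul, hx]
      rw [hx'] at h
      exact right_eq_add.1 h
    · have hre : ∑ v ∈ P, (A⁻¹ * c v) • v
          = ∑ v ∈ P, (A⁻¹ * (c v * u v)) • ((u v)⁻¹ • v) := by
        apply Finset.sum_congr rfl
        intro v hv
        have hv0 := (Finset.mem_filter.1 hv).2
        rw [smul_smul]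
        congr 1
        field_simp
      rw [hre]
      apply (convex_convexHull ℝ _).sum_mem
      · intro v hv
        have hv' := Finset.mem_filter.1 hv
        have := hc v hv'.1
        have := hv'.2
        positivity
      · rw [← Finset.mul_sum, ← hA, inv_mul_cancel₀ hA0.ne']
      · intro v hv
        have hv' := Finset.mem_filter.1 hv
        exact subset_convexHull ℝ _ ⟨v, ht hv'.1, hv'.2, rfl⟩
  · rintro x hx
    obtain ⟨a, ⟨ha, ha0⟩, b, hb, rfl⟩ := Set.mem_add.1 hx
    have hsub : convexHull ℝ {p | ∃ g ∈ G, 0 < u g ∧ p = (u g)⁻¹ • g} ⊆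
        coneGen G ∩ {p | u p = 1} := by
      apply convexHull_min
      · rintro p ⟨g, hg, hpos, rfl⟩
        refine ⟨coneGen_smul_mem (inv_nonneg.2 hpos.le) (subset_coneGen hg), ?_⟩
        simp [hpos.ne']
      · rintro p ⟨hp, hp1⟩ q ⟨hq, hq1⟩ r s hr hs hrs
        refine ⟨coneGen_add_mem (coneGen_smul_mem hr hp) (coneGen_smul_mem hs hq), ?_⟩
        simp only [Set.mem_ofPred_eq] at hp1 hq1 ⊢
        simp [hp1, hq1, hrs]
    obtain ⟨hb, hb1⟩ := hsub hb
    refine ⟨coneGen_add_mem ha hb, ?_⟩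
    simp only [Set.mem_ofPred_eq] at ha0 hb1 ⊢
    simp [ha0, hb1]

/-- **The height-one slice of the cone over a Newton polytope.** Let `k < 0 < l`, let
`S i ⊆ ℝ^m` be finite sets for `k ≤ i ≤ l`, nonempty for at least one `i > 0`, let
`σ ⊆ ℝ × ℝ × ℝ^m` be the convex cone generated by all `(1, i, v)` with `v ∈ S i`, and
let `u` be projection onto the second coordinate.  Then
`σ ∩ u⁻¹(1) = (σ ∩ u⁻¹(0)) + convexHull {(1/i) • (1, i, v) : 1 ≤ i ≤ l, v ∈ S i}`. -/
theorem slice_of_newton_cone {m : ℕ} (hm : 1 ≤ m) (k l : ℤ) (hk : k < 0) (hl : 0 < l)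
    (S : ℤ → Set (Fin m → ℝ))
    (hfin : ∀ i : ℤ, k ≤ i → i ≤ l → (S i).Finite)
    (hne : ∃ i : ℤ, 0 < i ∧ i ≤ l ∧ (S i).Nonempty) :
    coneGen {p : ℝ × ℝ × (Fin m → ℝ) |
        ∃ i : ℤ, k ≤ i ∧ i ≤ l ∧ ∃ v ∈ S i, p = ((1 : ℝ), (i : ℝ), v)} ∩
        {p | p.2.1 = 1} =
      (coneGen {p : ℝ × ℝ × (Fin m → ℝ) |
          ∃ i : ℤ, k ≤ i ∧ i ≤ l ∧ ∃ v ∈ S i, p = ((1 : ℝ), (i : ℝ), v)} ∩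
          {p | p.2.1 = 0}) +
        convexHull ℝ {p : ℝ × ℝ × (Fin m → ℝ) |
          ∃ i : ℤ, 1 ≤ i ∧ i ≤ l ∧ ∃ v ∈ S i, p = ((i : ℝ))⁻¹ • ((1 : ℝ), (i : ℝ), v)} := by
  have h := slice_general {p : ℝ × ℝ × (Fin m → ℝ) |
        ∃ i : ℤ, k ≤ i ∧ i ≤ l ∧ ∃ v ∈ S i, p = ((1 : ℝ), (i : ℝ), v)}
        ((LinearMap.fst ℝ ℝ (Fin m → ℝ)).comp (LinearMap.snd ℝ ℝ (ℝ × (Fin m → ℝ))))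
  simp only [LinearMap.comp_apply, LinearMap.fst_apply, LinearMap.snd_apply] at h
  rw [h]
  congr 2
  ext p
  constructor
  · rintro ⟨g, ⟨i, _, hil, v, hv, rfl⟩, hpos, rfl⟩
    have hi : 0 < i := Int.cast_pos.1 (show (0 : ℝ) < (i : ℝ) from hpos)
    exact ⟨i, hi, hil, v, hv, rfl⟩
  · rintro ⟨i, hi, hil, v, hv, rfl⟩
    refine ⟨_, ⟨i, by omega, hil, v, hv, rfl⟩, ?_, rfl⟩
    have : 0 < i := by omega
    exact (Int.cast_pos.2 this : (0 : ℝ) < (i : ℝ))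
end

section
/- Let V be a real vector space, let τ ⊆ V be a convex cone (containing 0), let C ⊆ V be a nonempty convex set, let e ∈ V, let I be a nonempty finite set of positive integers, and for each i ∈ I let B_i ⊆ V be a nonempty set. Then (τ + convexHull(⋃_{i ∈ I} (1/i) • (B_i + e))) + (τ + C) = τ + convexHull(⋃_{i ∈ I} (1/i) • ((B_i + i • C) + e)), where + denotes Minkowski sum, c • A = {c·a : a ∈ A}, and B + e = {b + e : b ∈ B}. -/
open scoped Pointwise

/-- **The Minkowski decomposition `Δ₀⁰ + Δ₀¹ = Δ₀`.** Let `V` be a real vector space,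
`τ ⊆ V` a convex cone (containing `0`, closed under addition and nonnegative scalar
multiplication), `C ⊆ V` a nonempty convex set, `e ∈ V`, `I` a finite nonempty set of
positive integers, and `B i` nonempty subsets of `V` for `i ∈ I`.  Then
`(τ + conv(⋃_{i∈I} (1/i)•(B i + e))) + (τ + C) = τ + conv(⋃_{i∈I} (1/i)•(B i + i•C + e))`. -/
theorem minkowski_decomposition {V : Type*} [AddCommGroup V] [Module ℝ V]
    (τ : Set V) (hτ0 : (0 : V) ∈ τ)
    (hτadd : ∀ x ∈ τ, ∀ y ∈ τ, x + y ∈ τ)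
    (hτsmul : ∀ (c : ℝ), 0 ≤ c → ∀ x ∈ τ, c • x ∈ τ)
    (C : Set V) (hC : Convex ℝ C) (hCne : C.Nonempty) (e : V)
    (I : Finset ℤ) (hI : I.Nonempty) (hIpos : ∀ i ∈ I, 0 < i)
    (B : ℤ → Set V) (hB : ∀ i ∈ I, (B i).Nonempty) :
    (τ + convexHull ℝ (⋃ i ∈ I, ((i : ℝ))⁻¹ • (B i + ({e} : Set V)))) + (τ + C) =
      τ + convexHull ℝ
        (⋃ i ∈ I, ((i : ℝ))⁻¹ • ((B i + (i : ℝ) • C) + ({e} : Set V))) := by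
  have hττ : τ + τ = τ := by
    apply Set.Subset.antisymm
    · rintro _ ⟨x, hx, y, hy, rfl⟩
      exact hτadd x hx y hy
    · intro x hx
      exact ⟨x, hx, 0, hτ0, add_zero x⟩
  have hU : (⋃ i ∈ I, ((i : ℝ))⁻¹ • ((B i + (i : ℝ) • C) + ({e} : Set V))) =
      (⋃ i ∈ I, ((i : ℝ))⁻¹ • (B i + ({e} : Set V))) + C := by
    rw [Set.iUnion₂_add]
    refine Set.iUnion₂_congr fun i hi => ?_
    have h0 : (i : ℝ) ≠ 0 := by exact_mod_cast (hIpos i hi).ne'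
    rw [add_right_comm, smul_add _ (B i + {e}), inv_smul_smul₀ h0]
  rw [hU, convexHull_add, hC.convexHull_eq, add_add_add_comm, hττ]
end
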